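/- Let 𝐢 be a Lyndon word, 𝐣 a dominant word with 𝐢 ⪰ 𝐣, and m a positive integer. Then max(𝐢^m ⋄ 𝐣) = max(𝐣 ⋄ 𝐢^m) = 𝐢^m𝐣 (where 𝐢^m𝐣 denotes concatenation). Moreover, if 𝐢 ≻ 𝐣, then the coefficient of the word 𝐢^m𝐣 in 𝐢^m ⋄ 𝐣 equals (−1)^{p(m𝐢)p(𝐣)} q^{−(m|𝐢|,|𝐣|)}. -/

import Mathlib

namespace SpinQHA

/-- The coefficient field `ℚ(q)`. -/
abbrev Kq : Type := RatFunc ℚ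

/-- The variable `q`. -/
noncomputable def qX : Kq := RatFunc.X

/-- Parity of the letter `i`.  The alphabet is `Fin (n+2)` (so the rank is `n+2 ≥ 2`);
the index `i` represents the letter `i+1`, and the last letter is the unique odd one. -/
def pa (n : ℕ) (i : Fin (n+2)) : ℕ := if (i : ℕ) = n+1 then 1 else 0

/-- Symmetrized Cartan matrix of `osp(1|2(n+2))`. -/
def cart (n : ℕ) (i j : Fin (n+2)) : ℤ :=
  if i = j then (if (i : ℕ) = n+1 then 2 else 4)
  else if (i : ℕ) + 1 = (j : ℕ) ∨ (j : ℕ) + 1 = (i : ℕ) then -2 else 0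

/-- Bilinear form on `Q⁺` (elements recorded by their coordinates). -/
def bil (n : ℕ) (μ ν : Fin (n+2) → ℕ) : ℤ :=
  ∑ i, ∑ j, (μ i : ℤ) * (ν j : ℤ) * cart n i j

/-- Weight `|w| ∈ Q⁺` of a word. -/
def wt (n : ℕ) (w : List (Fin (n+2))) : Fin (n+2) → ℕ := fun i => w.count i

/-- Parity (as a natural number, read mod 2) of a word. -/
def pw (n : ℕ) (w : List (Fin (n+2))) : ℕ := (w.map (pa n)).sum

/-- `F`, the free `ℚ(q)`-module on the set of words. -/
abbrev F (n : ℕ) : Type := List (Fin (n+2)) →₀ Kq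

/-- Quantum shuffle of two words, computed in the "reversed" representation where the
head of each list is the *last* letter of the corresponding word; this encodes the
inductive rule `(xi) ⋄ (yj) = (x ⋄ (yj))i + (-1)^{p(xi)p(j)} q^{-(|xi|,|j|)} ((xi) ⋄ y)j`. -/
noncomputable def shAux (n : ℕ) : List (Fin (n+2)) → List (Fin (n+2)) → F n
  | [], y => Finsupp.single y 1
  | x, [] => Finsupp.single x 1
  | i :: x, j :: y =>
      Finsupp.mapDomain (List.cons i) (shAux n x (j :: y))
      + ((-1 : Kq) ^ (pw n (i :: x) * pa n j)
          * qX ^ (-(bil n (wt n (i :: x)) (wt n [j])))) •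
          Finsupp.mapDomain (List.cons j) (shAux n (i :: x) y)
  termination_by x y => x.length + y.length

/-- Quantum shuffle product of two words. -/
noncomputable def shw (n : ℕ) (x y : List (Fin (n+2))) : F n :=
  Finsupp.mapDomain List.reverse (shAux n x.reverse y.reverse)

/-- The quantum shuffle product `⋄` on `F`, extended bilinearly. -/
noncomputable def diam (n : ℕ) (u v : F n) : F n :=
  u.sum fun x cx => v.sum fun y cy => (cx * cy) • shw n x y

/-- Strict lexicographic order `≺` on words. -/
def wlt (n : ℕ) (v w : List (Fin (n+2))) : Prop := List.Lex (· < ·) v w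

/-- A word is Lyndon if it is nonempty and lexicographically smaller than each of its
proper nonempty suffixes. -/
def IsLyndonW (n : ℕ) (w : List (Fin (n+2))) : Prop :=
  w ≠ [] ∧ ∀ s t : List (Fin (n+2)), w = s ++ t → s ≠ [] → t ≠ [] → wlt n w t

/-- Iterated shuffle products of one-letter words. -/
noncomputable def prodLetters (n : ℕ) : List (Fin (n+2)) → F n
  | [] => Finsupp.single [] 1
  | i :: l => diam n (Finsupp.single [i] 1) (prodLetters n l)

/-- `U`, the subalgebra of `(F,⋄)` generated by the one-letter words, realized as the
`ℚ(q)`-span of all iterated shuffle products of letters. -/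
noncomputable def Ualg (n : ℕ) : Submodule Kq (F n) :=
  Submodule.span Kq (Set.range (prodLetters n))

/-- `w = max(u)`: `w` is the lexicographically largest word occurring in `u` with
nonzero coefficient. -/
def IsMaxWord (n : ℕ) (u : F n) (w : List (Fin (n+2))) : Prop :=
  w ∈ u.support ∧ ∀ v ∈ u.support, v = w ∨ wlt n v w

/-- A word is dominant if it is the largest word of some `u ∈ U`. -/
def IsDominant (n : ℕ) (w : List (Fin (n+2))) : Prop :=
  ∃ u ∈ Ualg n, IsMaxWord n u w

/-- The `m`-fold concatenation `w^m` of a word. -/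
def rep (n : ℕ) (m : ℕ) (w : List (Fin (n+2))) : List (Fin (n+2)) :=
  (List.replicate m w).flatten

section Shuffles

theorem cons_le_cons_iff {α : Type*} [LinearOrder α] {a b : α} {x y : List α} :
    a :: x ≤ b :: y ↔ a < b ∨ a = b ∧ x ≤ y := by
  rw [← not_lt, List.cons_lt_cons_iff, ← not_lt (a := y)]
  rcases lt_trichotomy a b with h | h | h
  · simp [h, h.not_gt, h.ne']
  · simp [h]
  · simp [h, h.not_gt, h.ne']

theorem nil_le {α : Type*} [LinearOrder α] (x : List α) : [] ≤ x :=
  not_lt.1 (List.not_lt_nil x)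

variable {α β : Type*}

/-- `Shuffle x y w` says that the word `w` is a shuffle of the words `x` and `y`. -/
inductive Shuffle : List α → List α → List α → Prop
  | nil : Shuffle [] [] []
  | left {a x y w} : Shuffle x y w → Shuffle (a :: x) y (a :: w)
  | right {a x y w} : Shuffle x y w → Shuffle x (a :: y) (a :: w)

namespace Shuffle

theorem symm {x y w : List α} (h : Shuffle x y w) : Shuffle y x w := by
  induction h with
  | nil => exact nil
  | left _ ih => exact right ih
  | right _ ih => exact left ih

theorem nil_left : ∀ y : List α, Shuffle [] y y
  | [] => nil
  | _ :: y => right (nil_left y)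

theorem eq_of_nil_left {y w : List α} (h : Shuffle [] y w) : w = y := by
  generalize hx : ([] : List α) = x at h
  induction h with
  | nil => rfl
  | left => simp at hx
  | right _ ih => rw [ih hx]

theorem append (y : List α) : ∀ x : List α, Shuffle x y (x ++ y)
  | [] => nil_left y
  | _ :: x => left (append y x)

theorem append_left {x y w : List α} (h : Shuffle x y w) (t : List α) :
    Shuffle (x ++ t) y (w ++ t) := by
  induction h with
  | nil => exact (nil_left t).symm
  | left _ ih => exact left ih
  | right _ ih => exact right ih

theorem append_right {x y w : List α} (h : Shuffle x y w) (t : List α) :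
    Shuffle x (y ++ t) (w ++ t) :=
  (h.symm.append_left t).symm

theorem map (f : α → β) {x y w : List α} (h : Shuffle x y w) :
    Shuffle (x.map f) (y.map f) (w.map f) := by
  induction h with
  | nil => exact nil
  | left _ ih => exact left ih
  | right _ ih => exact right ih

variable [LinearOrder α]

/-- If `v ≤ u`, moving a common prefix `z` from `u` to `v` does not decrease the largest shuffle. -/
theorem exists_le_of_prefix (z u v w : List α) (hvu : v ≤ u) (h : Shuffle (z ++ u) v w) :
    ∃ w', Shuffle u (z ++ v) w' ∧ w ≤ w' := by
  match z, v, w, h with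
  | [], _, w, h => exact ⟨w, h, le_rfl⟩
  | c :: z, v, _ :: w, .left h =>
    obtain ⟨w', hw', hle⟩ := exists_le_of_prefix z u v w hvu h
    exact ⟨c :: w', right hw', cons_le_cons_iff.2 (Or.inr ⟨rfl, hle⟩)⟩
  | c :: z, b :: v, _ :: w, .right h =>
    match u, hvu, h with
    | [], hvu, _ => exact absurd (List.nil_lt_cons b v) hvu.not_gt
    | d :: u, hvu, h =>
      rcases cons_le_cons_iff.1 hvu with hlt | ⟨rfl, hle⟩
      · exact ⟨_, append _ _, cons_le_cons_iff.2 (Or.inl hlt)⟩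
      · obtain ⟨w', hw', hle'⟩ := exists_le_of_prefix (c :: z ++ [b]) u v w hle (by simpa using h)
        exact ⟨b :: w', left (by simpa using hw'), cons_le_cons_iff.2 (Or.inr ⟨rfl, hle'⟩)⟩
termination_by z.length + u.length + v.length

/-- If every nonempty suffix of `x` is at least `y`, then `x ++ y` is the largest shuffle
of `x` and `y`. -/
theorem le_append (x y w : List α) (hs : ∀ s, s <:+ x → s ≠ [] → y ≤ s) (h : Shuffle x y w) :
    w ≤ x ++ y := by
  induction x generalizing y w with
  | nil => rw [h.eq_of_nil_left, List.nil_append]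
  | cons a x ih =>
    have hs' : ∀ s, s <:+ x → s ≠ [] → y ≤ s := fun s h₁ =>
      hs s (h₁.trans (List.suffix_cons a x))
    have hyx := hs (a :: x) List.suffix_rfl (by simp)
    match y, w, h with
    | y, _ :: w, .left h => exact cons_le_cons_iff.2 (Or.inr ⟨rfl, ih y w hs' h⟩)
    | b :: y, _ :: w, .right h =>
      rcases cons_le_cons_iff.1 hyx with hlt | ⟨rfl, hle⟩
      · exact cons_le_cons_iff.2 (Or.inl hlt)
      · obtain ⟨w', hw', hle'⟩ := exists_le_of_prefix [b] x y w hle h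
        exact cons_le_cons_iff.2 (Or.inr ⟨rfl, hle'.trans (ih _ w' hs' hw')⟩)

end Shuffle

end Shuffles

section Lowering

variable {N : ℕ}

/-- Embedding of the letters into `ℕ` leaving room for a lowered copy `2 * a` of each letter `a`. -/
def raise (a : Fin N) : ℕ := 2 * a + 1

theorem map_raise_le_of_lt (y s : List (Fin N)) (c : Fin N) (h : y < s ++ [c]) :
    y.map raise ≤ s.map raise ++ [2 * (c : ℕ)] := by
  induction y generalizing s with
  | nil => exact nil_le _
  | cons b y ih =>
    cases s with
    | nil =>
      simp [List.cons_lt_cons_iff] at h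
      refine cons_le_cons_iff.2 (Or.inl ?_)
      simp only [raise]; omega
    | cons a s =>
      rcases List.cons_lt_cons_iff.1 h with hlt | ⟨rfl, hlt⟩
      · refine cons_le_cons_iff.2 (Or.inl ?_)
        simp only [raise]; omega
      · exact cons_le_cons_iff.2 (Or.inr ⟨rfl, ih s hlt⟩)

theorem append_lt_append_left {α : Type*} [LinearOrder α] (l : List α) {x y : List α}
    (h : x < y) : l ++ x < l ++ y :=
  List.Lex.append_left _ h l

theorem map_raise_append_le (y s : List (Fin N)) (d c : Fin N) (h : y ++ [d] ≤ s ++ [c]) :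
    y.map raise ++ [2 * (d : ℕ)] ≤ s.map raise ++ [2 * (c : ℕ)] := by
  rcases h.lt_or_eq with h | h
  · refine le_trans (le_of_lt ?_) (map_raise_le_of_lt _ s c h)
    rw [List.map_append]
    exact append_lt_append_left _ (List.cons_lt_cons_iff.2 (Or.inl (by simp [raise])))
  · obtain ⟨rfl, h⟩ := List.append_inj' h rfl
    simp_all

/-- A shuffle with `x ++ [c]`, its last letter lowered, cannot start with the unlowered word. -/
theorem not_shuffle_lowered (x : List (Fin N)) (c : Fin N) (y t : List ℕ)
    (hs : ∀ s, s <:+ x → y ≤ s.map raise ++ [2 * (c : ℕ)]) :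
    ¬ Shuffle (x.map raise ++ [2 * (c : ℕ)]) y (x.map raise ++ raise c :: t) := by
  intro h
  have hle := Shuffle.le_append _ _ _ ?_ h
  · refine absurd hle (not_le.2 ?_)
    rw [List.append_assoc]
    exact append_lt_append_left _ (List.cons_lt_cons_iff.2 (Or.inl (by simp [raise])))
  · intro s hsx hne
    obtain ⟨s', a, rfl⟩ := List.eq_nil_or_concat s |>.resolve_left hne
    rw [List.concat_eq_append] at *
    obtain ⟨r, hr⟩ := hsx
    rw [← List.append_assoc] at hr
    obtain ⟨hr, ha⟩ := List.append_inj' hr rfl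
    obtain ⟨r', s₀, rfl, -, rfl⟩ := List.map_eq_append_iff.1 hr.symm
    rw [ha]
    exact hs s₀ (List.suffix_append _ _)

theorem not_shuffle_of_lt (x y : List (Fin N)) (c : Fin N)
    (hs : ∀ s, s <:+ x ++ [c] → s ≠ [] → y ++ [c] < s) :
    ¬ Shuffle x (y ++ [c]) (x ++ c :: y) := by
  intro h
  refine not_shuffle_lowered x c ((y ++ [c]).map raise) (y.map raise ++ [2 * (c : ℕ)])
    (fun s hsx => map_raise_le_of_lt _ _ _ (hs _ ?_ (by simp))) ?_
  · obtain ⟨r, rfl⟩ := hsx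
    exact ⟨r, by simp⟩
  · simpa using (h.map raise).append_left [2 * (c : ℕ)]

theorem not_shuffle_of_le (x p r : List (Fin N)) (e : Fin N)
    (hs : ∀ s, s <:+ x ++ (p ++ e :: r ++ [e]) → s ≠ [] → p ++ e :: r ++ [e] ≤ s) :
    ¬ Shuffle (x ++ (p ++ [e])) (p ++ e :: r) (x ++ (p ++ e :: r ++ [e]) ++ p) := by
  intro h
  refine not_shuffle_lowered (x ++ (p ++ e :: r)) e ((p ++ e :: r).map raise ++ [2 * (e : ℕ)])
    (p.map raise ++ [2 * (e : ℕ)] ++ (r.map raise ++ [2 * (e : ℕ)]))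
    (fun s hsx => map_raise_append_le _ _ _ _ (hs _ ?_ (by simp))) ?_
  · obtain ⟨t, ht⟩ := hsx
    exact ⟨t, by rw [← List.append_assoc, ht, List.append_assoc]⟩
  · simpa using ((h.map raise).append_right [2 * (e : ℕ)]).append_left
      (r.map raise ++ [2 * (e : ℕ)])

end Lowering

section BilinearForm

variable (n : ℕ)

theorem wt_append (x y : List (Fin (n+2))) : wt n (x ++ y) = wt n x + wt n y := by
  ext a
  simp [wt]

theorem bil_add_left (μ μ' ν : Fin (n+2) → ℕ) : bil n (μ + μ') ν = bil n μ ν + bil n μ' ν := by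
  simp [bil, add_mul, Finset.sum_add_distrib]

theorem bil_add_right (μ ν ν' : Fin (n+2) → ℕ) : bil n μ (ν + ν') = bil n μ ν + bil n μ ν' := by
  simp [bil, mul_add, add_mul, Finset.sum_add_distrib]

theorem pw_append (x y : List (Fin (n+2))) : pw n (x ++ y) = pw n x + pw n y := by
  simp [pw]

/-- Entries of the infinite Cartan matrix of type `A`, rescaled by `2`. -/
def cartA (i j : ℕ) : ℤ := if i = j then 4 else if i + 1 = j ∨ j + 1 = i then -2 else 0

theorem sum_cartA_last (g : ℕ → ℤ) (N : ℕ) :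
    ∑ j ∈ Finset.range (N+1), g j * cartA (N+1) j = -2 * g N := by
  rw [Finset.sum_range_succ, Finset.sum_eq_zero]
  · simp [cartA]; ring
  · intro j hj
    rw [Finset.mem_range] at hj
    rw [cartA, if_neg (by omega), if_neg (by omega), mul_zero]

theorem cartA_comm (i j : ℕ) : cartA i j = cartA j i := by
  simp only [cartA, eq_comm, or_comm]

theorem sum_sum_cartA (g : ℕ → ℤ) (N : ℕ) :
    ∑ i ∈ Finset.range (N+1), ∑ j ∈ Finset.range (N+1), g i * g j * cartA i j
      = 2 * g N ^ 2 + 2 * (g 0 ^ 2 + ∑ k ∈ Finset.range N, (g k - g (k+1)) ^ 2) := by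
  induction N with
  | zero => simp [cartA]; ring
  | succ N ih =>
    have hrow : ∑ j ∈ Finset.range (N+1), g (N+1) * g j * cartA (N+1) j
        = g (N+1) * (-2 * g N) := by
      rw [← sum_cartA_last, Finset.mul_sum]
      simp only [mul_assoc]
    have hcol : ∑ i ∈ Finset.range (N+1), g i * g (N+1) * cartA i (N+1)
        = g (N+1) * (-2 * g N) := by
      rw [← hrow]
      refine Finset.sum_congr rfl fun i _ => ?_
      rw [cartA_comm]; ring
    have hdiag : cartA (N+1) (N+1) = 4 := by simp [cartA]
    rw [Finset.sum_range_succ]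
    simp_rw [Finset.sum_range_succ _ (N+1)]
    rw [Finset.sum_add_distrib, ih, hrow, hcol, hdiag, Finset.sum_range_succ _ N]
    ring

theorem cart_eq (i j : Fin (n+2)) :
    cart n i j = cartA i j - if (i : ℕ) = n+1 ∧ (j : ℕ) = n+1 then 2 else 0 := by
  simp only [cart, cartA, Fin.ext_iff]
  split_ifs <;> omega

theorem bil_self (g : ℕ → ℕ) :
    bil n (fun i => g i) (fun i => g i) =
      2 * ((g 0 : ℤ) ^ 2 + ∑ k ∈ Finset.range (n+1), ((g k : ℤ) - g (k+1)) ^ 2) := by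
  have h := sum_sum_cartA (fun k => (g k : ℤ)) (n+1)
  simp only [Finset.sum_range] at h
  have hlast : ∑ i : Fin (n+2), ∑ j : Fin (n+2), ((g i : ℤ) * g j *
      if (i : ℕ) = n+1 ∧ (j : ℕ) = n+1 then 2 else 0) = 2 * (g (n+1) : ℤ) ^ 2 := by
    rw [Fin.sum_univ_castSucc, Finset.sum_eq_zero, Fin.sum_univ_castSucc, Finset.sum_eq_zero]
    · simp; ring
    · intro j _
      simp [j.isLt.ne]
    · intro i _
      simp [i.isLt.ne]
  simp only [bil, cart_eq, mul_sub, Finset.sum_sub_distrib]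
  rw [hlast, h, Finset.sum_range]
  ring

theorem bil_wt_self_pos {w : List (Fin (n+2))} (hw : w ≠ []) : 0 < bil n (wt n w) (wt n w) := by
  obtain ⟨g, hg⟩ : ∃ g : ℕ → ℕ, wt n w = fun i : Fin (n+2) => g i :=
    ⟨fun k => if h : k < n+2 then wt n w ⟨k, h⟩ else 0, by ext i; simp⟩
  have hsum : 0 ≤ ∑ k ∈ Finset.range (n+1), ((g k : ℤ) - g (k+1)) ^ 2 :=
    Finset.sum_nonneg fun _ _ => sq_nonneg _
  rw [hg, bil_self]
  by_contra hle
  have h0 : (g 0 : ℤ) ^ 2 = 0 := by nlinarith [sq_nonneg (g 0 : ℤ)]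
  have h1 : ∑ k ∈ Finset.range (n+1), ((g k : ℤ) - g (k+1)) ^ 2 = 0 := by
    nlinarith [sq_nonneg (g 0 : ℤ)]
  rw [Finset.sum_eq_zero_iff_of_nonneg fun _ _ => sq_nonneg _] at h1
  have hz : ∀ k < n+2, g k = 0 := by
    intro k
    induction k with
    | zero => intro _; simpa using h0
    | succ k ih =>
      intro hk
      have h2 := h1 k (Finset.mem_range.2 (by omega))
      have h3 := ih (by omega)
      simpa [h3] using h2
  obtain ⟨a, t, rfl⟩ := List.exists_cons_of_ne_nil hw
  have := congrFun hg a
  simp [hz a a.isLt, wt] at this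

end BilinearForm

section Coefficients

variable (n : ℕ)

/-- The scalar `(-1)^{p(x)p(y)} q^{-(|x|,|y|)}` produced when `y` moves past `x`. -/
noncomputable def twist (x y : List (Fin (n+2))) : Kq :=
  (-1 : Kq) ^ (pw n x * pw n y) * qX ^ (-(bil n (wt n x) (wt n y)))

theorem qX_ne_zero : qX ≠ 0 := RatFunc.X_ne_zero

theorem twist_append_left (x x' y : List (Fin (n+2))) :
    twist n (x ++ x') y = twist n x y * twist n x' y := by
  simp only [twist, pw_append, wt_append, bil_add_left, add_mul, neg_add, pow_add,
    zpow_add₀ qX_ne_zero]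
  ring

theorem twist_append_right (x y y' : List (Fin (n+2))) :
    twist n x (y ++ y') = twist n x y * twist n x y' := by
  simp only [twist, pw_append, wt_append, bil_add_right, mul_add, neg_add, pow_add,
    zpow_add₀ qX_ne_zero]
  ring

theorem twist_nil_left (y : List (Fin (n+2))) : twist n [] y = 1 := by
  simp [twist, pw, wt, bil]

theorem twist_nil_right (x : List (Fin (n+2))) : twist n x [] = 1 := by
  simp [twist, pw, wt, bil]

theorem qX_pow_ne_one {k : ℕ} (hk : k ≠ 0) : qX ^ k ≠ 1 := by
  intro h
  rw [qX, ← RatFunc.algebraMap_X, ← map_pow,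
    ← map_one (algebraMap (Polynomial ℚ) (RatFunc ℚ))] at h
  have h' := congrArg Polynomial.natDegree (RatFunc.algebraMap_injective ℚ h)
  simp [hk] at h'

theorem geom_sum_twist_ne_zero {w : List (Fin (n+2))} (hw : w ≠ []) (m : ℕ) :
    ∑ k ∈ Finset.range (m+1), twist n w w ^ k ≠ 0 := by
  intro h
  have h1 : twist n w w ^ (m+1) = 1 := by
    have := geom_sum_mul (twist n w w) (m+1)
    rw [h, zero_mul] at this
    exact (sub_eq_zero.1 this.symm)
  obtain ⟨e, he⟩ := Int.eq_ofNat_of_zero_le (bil_wt_self_pos n hw).le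
  have hpos := bil_wt_self_pos n hw
  rw [he] at hpos
  have h2 : (twist n w w ^ (m+1)) ^ 2 = 1 := by rw [h1, one_pow]
  have h3 : (twist n w w ^ (m+1)) ^ 2 = (qX ^ (e * (m+1) * 2))⁻¹ := by
    rw [twist, he, zpow_neg, zpow_natCast, mul_pow, mul_pow, inv_pow, inv_pow, ← pow_mul,
      ← pow_mul, ← pow_mul, ← pow_mul, Even.neg_one_pow ((even_two.mul_left _).mul_left _), one_mul, mul_assoc]
  rw [h3, inv_eq_one] at h2
  refine qX_pow_ne_one ?_ h2
  have : 0 < e := by exact_mod_cast hpos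
  positivity

theorem shAux_nil_right (x : List (Fin (n+2))) : shAux n x [] = Finsupp.single x 1 := by
  cases x <;> simp [shAux]

theorem shw_nil_left (y : List (Fin (n+2))) : shw n [] y = Finsupp.single y 1 := by
  simp [shw, shAux, Finsupp.mapDomain_single]

theorem shw_nil_right (x : List (Fin (n+2))) : shw n x [] = Finsupp.single x 1 := by
  simp [shw, shAux_nil_right, Finsupp.mapDomain_single]

theorem mapDomain_cons_apply (a c : Fin (n+2)) (u : F n) (w : List (Fin (n+2))) :
    Finsupp.mapDomain (List.cons a) u (c :: w) = if a = c then u w else 0 := by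
  split_ifs with h
  · subst h
    exact Finsupp.mapDomain_apply List.cons_injective u w
  · refine Finsupp.mapDomain_of_notMem_range u _ ?_
    rintro ⟨t, ht⟩
    exact h (List.cons.inj ht).1

theorem shw_apply (x y w : List (Fin (n+2))) :
    shw n x y w = shAux n x.reverse y.reverse w.reverse := by
  conv_lhs => rw [← List.reverse_reverse w]
  exact Finsupp.mapDomain_apply List.reverse_injective _ _

theorem shw_append_singleton (x y w : List (Fin (n+2))) (a b c : Fin (n+2)) :
    shw n (x ++ [a]) (y ++ [b]) (w ++ [c]) =
      (if a = c then shw n x (y ++ [b]) w else 0)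
        + twist n (x ++ [a]) [b] * (if b = c then shw n (x ++ [a]) y w else 0) := by
  have hpw : pw n (a :: x.reverse) = pw n (x ++ [a]) := by
    simp [pw, List.sum_reverse, add_comm]
  have hwt : wt n (a :: x.reverse) = wt n (x ++ [a]) := by
    ext k; simp [wt, List.count_cons, List.count_append]
  simp only [shw_apply, List.reverse_append, List.reverse_singleton, List.singleton_append]
  rw [shAux, Finsupp.add_apply, Finsupp.smul_apply, mapDomain_cons_apply, mapDomain_cons_apply,
    smul_eq_mul, hpw, hwt]
  simp [twist, pw]

theorem shuffle_of_shAux_ne_zero (x y w : List (Fin (n+2))) (h : shAux n x y w ≠ 0) :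
    Shuffle x y w := by
  match x, y with
  | [], y =>
    simp only [shAux, Finsupp.single_apply] at h
    obtain rfl : y = w := by by_contra hne; simp [hne] at h
    exact Shuffle.nil_left _
  | i :: x, [] =>
    simp only [shAux, Finsupp.single_apply] at h
    obtain rfl : i :: x = w := by by_contra hne; simp [hne] at h
    exact (Shuffle.nil_left _).symm
  | i :: x, j :: y =>
    rw [shAux, Finsupp.add_apply, Finsupp.smul_apply] at h
    cases w with
    | nil =>
      rw [Finsupp.mapDomain_of_notMem_range _ _ (by simp), Finsupp.mapDomain_of_notMem_range _ _ (by simp)]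
        at h
      simp at h
    | cons c w =>
      rw [mapDomain_cons_apply, mapDomain_cons_apply] at h
      by_cases h1 : i = c ∧ shAux n x (j :: y) w ≠ 0
      · obtain ⟨rfl, h1⟩ := h1
        exact Shuffle.left (shuffle_of_shAux_ne_zero x (j :: y) w h1)
      · by_cases h2 : j = c ∧ shAux n (i :: x) y w ≠ 0
        · obtain ⟨rfl, h2⟩ := h2
          exact Shuffle.right (shuffle_of_shAux_ne_zero (i :: x) y w h2)
        · refine absurd ?_ h
          split_ifs <;> simp_all
termination_by x.length + y.length

theorem Shuffle.reverse {α : Type*} {x y w : List α} (h : Shuffle x y w) :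
    Shuffle x.reverse y.reverse w.reverse := by
  induction h with
  | nil => exact nil
  | left _ ih => simpa using ih.append_left _
  | right _ ih => simpa using ih.append_right _

theorem shuffle_of_shw_ne_zero {x y w : List (Fin (n+2))} (h : shw n x y w ≠ 0) :
    Shuffle x y w := by
  rw [shw_apply] at h
  simpa using (shuffle_of_shAux_ne_zero n _ _ _ h).reverse

theorem shw_eq_zero {x y w : List (Fin (n+2))} (h : ¬ Shuffle x y w) : shw n x y w = 0 :=
  not_not.1 (mt (shuffle_of_shw_ne_zero n) h)

end Coefficients

section LeadingCoefficients

variable (n : ℕ)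

theorem le_append_right {α : Type*} [LinearOrder α] (y t : List α) : y ≤ y ++ t := by
  conv_lhs => rw [← List.append_nil y]
  rcases (nil_le t).lt_or_eq with h | h
  · exact (append_lt_append_left y h).le
  · rw [← h]

theorem lt_of_append_lt {α : Type*} [LinearOrder α] {y t s : List α} (h : y ++ t < s) : y < s :=
  lt_of_le_of_lt (le_append_right y t) h

theorem shw_append_of_lt (x y : List (Fin (n+2))) (hs : ∀ s, s <:+ x → s ≠ [] → y < s) :
    shw n x y (x ++ y) = twist n x y := by
  induction y using List.reverseRecOn with
  | nil => simp [shw_nil_right, twist_nil_right]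
  | append_singleton y d ih =>
    have hy := ih fun s h₁ h₂ => lt_of_append_lt (hs s h₁ h₂)
    obtain rfl | ⟨x, c, rfl⟩ := List.eq_nil_or_concat x
    · simp [shw_nil_left, twist_nil_left]
    rw [List.concat_eq_append] at *
    rw [← List.append_assoc, shw_append_singleton, if_pos rfl, hy, twist_append_right n _ y]
    split_ifs with h
    · subst h
      rw [shw_eq_zero n (by simpa using not_shuffle_of_lt x y c hs)]
      ring
    · ring

theorem shw_swap_append_of_lt (x y : List (Fin (n+2))) (hs : ∀ s, s <:+ x → s ≠ [] → y < s) :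
    shw n y x (x ++ y) = 1 := by
  induction y using List.reverseRecOn with
  | nil => simp [shw_nil_left]
  | append_singleton y d ih =>
    have hy := ih fun s h₁ h₂ => lt_of_append_lt (hs s h₁ h₂)
    obtain rfl | ⟨x, c, rfl⟩ := List.eq_nil_or_concat x
    · simp [shw_nil_right]
    rw [List.concat_eq_append] at *
    rw [← List.append_assoc, shw_append_singleton, if_pos rfl, hy]
    split_ifs with h
    · subst h
      rw [shw_eq_zero n (by simpa using mt Shuffle.symm (not_shuffle_of_lt x y c hs))]
      ring
    · ring

theorem rep_succ (m : ℕ) (w : List (Fin (n+2))) : rep n (m+1) w = rep n m w ++ w := by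
  simp [rep, List.replicate_succ']

theorem rep_succ' (m : ℕ) (w : List (Fin (n+2))) : rep n (m+1) w = w ++ rep n m w := by
  simp [rep, List.replicate_succ]

theorem twist_rep_left (m : ℕ) (w y : List (Fin (n+2))) :
    twist n (rep n m w) y = twist n w y ^ m := by
  induction m with
  | zero => simp [rep, twist_nil_left]
  | succ m ih => rw [rep_succ, twist_append_left, ih, pow_succ]

theorem IsLyndonW.le_of_suffix_rep {i : List (Fin (n+2))} (hi : IsLyndonW n i) (m : ℕ)
    (s : List (Fin (n+2))) (hs : s <:+ rep n m i) (hne : s ≠ []) : i ≤ s := by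
  induction m generalizing s with
  | zero => simp_all [rep]
  | succ m ih =>
    rw [rep_succ'] at hs
    obtain ⟨r, hr⟩ := hs
    rcases List.append_eq_append_iff.1 hr with ⟨t, rfl, rfl⟩ | ⟨t, rfl, h⟩
    · rcases eq_or_ne t [] with rfl | ht
      · exact ih _ (by simp) hne
      · refine le_trans ?_ (le_append_right t _)
        rcases eq_or_ne r [] with rfl | hr'
        · simp
        · exact le_of_lt (hi.2 r t rfl hr' ht)
    · exact ih s ⟨t, h.symm⟩ hne

variable {n}

theorem shw_rep_append_prefix {i : List (Fin (n+2))} (hi : IsLyndonW n i)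
    (m : ℕ) (p r : List (Fin (n+2))) (hpr : i = p ++ r) (hr : r ≠ []) :
    shw n (rep n m i ++ p) i (rep n (m+1) i ++ p) = shw n (rep n m i) i (rep n (m+1) i) := by
  induction p using List.reverseRecOn generalizing r with
  | nil => simp
  | append_singleton p e ih =>
    obtain ⟨r, f, rfl⟩ := (List.eq_nil_or_concat r).resolve_left hr
    rw [List.concat_eq_append] at *
    have hi' : i = p ++ e :: r ++ [f] := by simp [hpr]
    rw [← ih (e :: (r ++ [f])) (by simp [hpr]) (by simp)]
    rw [← List.append_assoc, ← List.append_assoc]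
    conv_lhs => arg 1; arg 3; rw [hi']
    rw [shw_append_singleton, if_pos rfl, ← hi']
    split_ifs with h
    · subst h
      rw [shw_eq_zero n (y := p ++ f :: r), mul_zero, add_zero]
      have := not_shuffle_of_le (rep n m i) p r f
      rw [← hi', ← rep_succ] at this
      simpa using this (hi.le_of_suffix_rep n (m+1))
    · ring

theorem shw_swap_rep_append_prefix {i : List (Fin (n+2))} (hi : IsLyndonW n i)
    (m : ℕ) (p r : List (Fin (n+2))) (hpr : i = p ++ r)
    (hr : r ≠ []) :
    shw n i (rep n m i ++ p) (rep n (m+1) i ++ p)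
      = twist n i p * shw n i (rep n m i) (rep n (m+1) i) := by
  induction p using List.reverseRecOn generalizing r with
  | nil => simp [twist_nil_right]
  | append_singleton p e ih =>
    obtain ⟨r, f, rfl⟩ := (List.eq_nil_or_concat r).resolve_left hr
    rw [List.concat_eq_append] at *
    have hi' : i = p ++ e :: r ++ [f] := by simp [hpr]
    rw [twist_append_right, mul_right_comm, ← ih (e :: (r ++ [f])) (by simp [hpr]) (by simp)]
    rw [← List.append_assoc, ← List.append_assoc]
    conv_lhs => arg 1; arg 2; rw [hi']
    rw [shw_append_singleton, if_pos rfl, ← hi']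
    split_ifs with h
    · subst h
      rw [shw_eq_zero n, zero_add, mul_comm]
      have := not_shuffle_of_le (rep n m i) p r f
      rw [← hi', ← rep_succ] at this
      simpa using mt Shuffle.symm (this (hi.le_of_suffix_rep n (m+1)))
    · ring

theorem shw_rep_self {i : List (Fin (n+2))} (hi : IsLyndonW n i)
    (m : ℕ) :
    shw n (rep n m i) i (rep n (m+1) i) = ∑ k ∈ Finset.range (m+1), twist n i i ^ k := by
  induction m with
  | zero => simp [rep, shw_nil_left]
  | succ m ih =>
    obtain ⟨p, d, hpd⟩ := (List.eq_nil_or_concat i).resolve_left hi.1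
    rw [List.concat_eq_append] at hpd
    have hp : shw n (rep n (m+1) i) p (rep n (m+1) i ++ p) = twist n (rep n (m+1) i) p :=
      shw_append_of_lt n _ _ fun s h₁ h₂ => lt_of_lt_of_le
        (by conv_rhs => rw [hpd]
            simpa using append_lt_append_left p (List.nil_lt_cons d []))
        (hi.le_of_suffix_rep n (m+1) s h₁ h₂)
    have h₁ : rep n (m+1) i = rep n m i ++ p ++ [d] := by
      rw [rep_succ, List.append_assoc, ← hpd]
    have h₂ : rep n (m+1+1) i = rep n (m+1) i ++ p ++ [d] := by
      rw [rep_succ _ (m+1), List.append_assoc, ← hpd]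
    have key := shw_append_singleton n (rep n m i ++ p) p (rep n (m+1) i ++ p) d d d
    rw [if_pos rfl, if_pos rfl, ← h₁, ← h₂, ← hpd, hp,
      shw_rep_append_prefix hi m p [d] hpd (by simp),
      ih, mul_comm, ← twist_append_right, ← hpd, twist_rep_left] at key
    rw [key, Finset.sum_range_succ _ (m+1)]

theorem shw_swap_rep_self {i : List (Fin (n+2))} (hi : IsLyndonW n i)
    (m : ℕ) :
    shw n i (rep n m i) (rep n (m+1) i) = ∑ k ∈ Finset.range (m+1), twist n i i ^ k := by
  induction m with
  | zero => simp [rep, shw_nil_right]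
  | succ m ih =>
    obtain ⟨p, d, hpd⟩ := (List.eq_nil_or_concat i).resolve_left hi.1
    rw [List.concat_eq_append] at hpd
    have hp : shw n p (rep n (m+1) i) (rep n (m+1) i ++ p) = 1 :=
      shw_swap_append_of_lt n _ _ fun s h₁ h₂ => lt_of_lt_of_le
        (by conv_rhs => rw [hpd]
            simpa using append_lt_append_left p (List.nil_lt_cons d []))
        (hi.le_of_suffix_rep n (m+1) s h₁ h₂)
    have h₁ : rep n (m+1) i = rep n m i ++ p ++ [d] := by
      rw [rep_succ, List.append_assoc, ← hpd]
    have h₂ : rep n (m+1+1) i = rep n (m+1) i ++ p ++ [d] := by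
      rw [rep_succ _ (m+1), List.append_assoc, ← hpd]
    have key := shw_append_singleton n p (rep n m i ++ p) (rep n (m+1) i ++ p) d d d
    rw [if_pos rfl, if_pos rfl, ← h₁, ← h₂, ← hpd, hp,
      shw_swap_rep_append_prefix hi m p [d] hpd (by simp),
      ih, ← mul_assoc, mul_comm (twist n i [d]), ← twist_append_right, ← hpd] at key
    rw [key, Finset.sum_range_succ' _ (m+1), Finset.mul_sum, pow_zero, add_comm]
    simp only [pow_succ']

end LeadingCoefficients

/-- Let `𝐢` be a Lyndon word, `𝐣` a dominant word with `𝐢 ⪰ 𝐣`,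
and `m > 0`.  Then `max(𝐢^m ⋄ 𝐣) = max(𝐣 ⋄ 𝐢^m) = 𝐢^m 𝐣`; moreover if `𝐢 ≻ 𝐣`
then the coefficient of the word `𝐢^m 𝐣` in `𝐢^m ⋄ 𝐣` equals
`(-1)^{p(m𝐢)p(𝐣)} q^{-(m|𝐢|,|𝐣|)}`. -/
theorem stmt10 (n m : ℕ) (hm : 0 < m) (i j : List (Fin (n+2)))
    (hi : IsLyndonW n i) (hj : IsDominant n j) (hij : j = i ∨ wlt n j i) :
    IsMaxWord n (shw n (rep n m i) j) (rep n m i ++ j) ∧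
    IsMaxWord n (shw n j (rep n m i)) (rep n m i ++ j) ∧
    (wlt n j i →
      (shw n (rep n m i) j) (rep n m i ++ j)
        = (-1 : Kq) ^ (pw n (rep n m i) * pw n j)
            * qX ^ (-(bil n (wt n (rep n m i)) (wt n j)))) := by
  have hle := hi.le_of_suffix_rep n m
  have hji : j ≤ i := hij.elim le_of_eq fun h => le_of_lt h
  have hmax : ∀ v, Shuffle (rep n m i) j v → v = rep n m i ++ j ∨ wlt n v (rep n m i ++ j) :=
    fun v hv => (Shuffle.le_append _ _ _ (fun s h₁ h₂ => hji.trans (hle s h₁ h₂)) hv).eq_or_lt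
  have hlt (h : wlt n j i) (s) (h₁ : s <:+ rep n m i) (h₂ : s ≠ []) : j < s :=
    lt_of_lt_of_le (show j < i from h) (hle s h₁ h₂)
  refine ⟨⟨Finsupp.mem_support_iff.2 ?_, fun v hv =>
      hmax v (shuffle_of_shw_ne_zero n (Finsupp.mem_support_iff.1 hv))⟩,
    ⟨Finsupp.mem_support_iff.2 ?_, fun v hv =>
      hmax v (shuffle_of_shw_ne_zero n (Finsupp.mem_support_iff.1 hv)).symm⟩,
    fun h => shw_append_of_lt n _ _ (hlt h)⟩
  · rcases hij with rfl | h
    · rw [← rep_succ, shw_rep_self hi]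
      exact geom_sum_twist_ne_zero n hi.1 m
    · rw [shw_append_of_lt n _ _ (hlt h)]
      exact mul_ne_zero (pow_ne_zero _ (by simp)) (zpow_ne_zero _ qX_ne_zero)
  · rcases hij with rfl | h
    · rw [← rep_succ, shw_swap_rep_self hi]
      exact geom_sum_twist_ne_zero n hi.1 m
    · rw [shw_swap_append_of_lt n _ _ (hlt h)]
      exact one_ne_zero

end SpinQHA
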